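/- Fix z ∈ V and for b ∈ ℕ let p_b = Σ_{i∈V} Σ_{η∈Rec(z)} (α_i/κ)·1{av_{i→z}(η) = b}. Then the expected burst size of the threshold avalanche converges to the second moment of the stationary burst size: E_{s_0}[ av_{i_τ→z}(ρ_τ) ] → Σ_{b≥0} b²·p_b as |s_0| → −∞. -/

import Mathlib

open scoped BigOperators
open Classical Filter

noncomputable section

namespace ThresholdState

variable {V : Type*} [Fintype V] [DecidableEq V]

/-- `A i j` is the number of directed edges from `i` to `j`. -/
def outdeg (A : V → V → ℕ) (i : V) : ℕ := ∑ j, A i j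

def indeg (A : V → V → ℕ) (i : V) : ℕ := ∑ j, A j i

/-- Eulerian: out-degree equals in-degree at every vertex. -/
def Eulerian (A : V → V → ℕ) : Prop := ∀ i, outdeg A i = indeg A i

/-- (Strongly) connected multigraph. -/
def Connected (A : V → V → ℕ) : Prop :=
  ∀ i j : V, Relation.ReflTransGen (fun a b => 0 < A a b) i j

def deg (A : V → V → ℕ) (i : V) : ℕ := outdeg A i

/-- Graph Laplacian: `Δu(i) = -deg(i)·u(i) + Σ_{e incoming to i} u(e⁻)`. -/
def lap (A : V → V → ℕ) (u : V → ℤ) (i : V) : ℤ :=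
  -(deg A i : ℤ) * u i + ∑ j, (A j i : ℤ) * u j

def delta (z : V) : V → ℤ := fun j => if j = z then 1 else 0

/-- Toppling vertex `i`: replace `s` by `s + Δδ_i`. -/
def toppleAt (A : V → V → ℕ) (s : V → ℤ) (i : V) : V → ℤ :=
  fun j => s j + lap A (delta i) j

def applySeq (A : V → V → ℕ) (s : V → ℤ) (l : List V) : V → ℤ :=
  l.foldl (toppleAt A) s

/-- A legal toppling sequence (avoiding the forbidden set `F`): each toppled
vertex is unstable when toppled and does not lie in `F`. -/
def ValidSeq (A : V → V → ℕ) (F : V → Prop) : (V → ℤ) → List V → Prop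
  | _, [] => True
  | s, i :: l => ¬ F i ∧ (deg A i : ℤ) ≤ s i ∧ ValidSeq A F (toppleAt A s i) l

/-- Stable at every non-forbidden vertex. -/
def StableOff (A : V → V → ℕ) (F : V → Prop) (s : V → ℤ) : Prop :=
  ∀ i, ¬ F i → s i ≤ (deg A i : ℤ) - 1

def StabilizesTo (A : V → V → ℕ) (F : V → Prop) (s : V → ℤ) (l : List V) : Prop :=
  ValidSeq A F s l ∧ StableOff A F (applySeq A s l)

def StabilizableVia (A : V → V → ℕ) (F : V → Prop) (s : V → ℤ) : Prop :=
  ∃ l, StabilizesTo A F s l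

/-- Stabilizable with no forbidden vertices. -/
def Stabilizable (A : V → V → ℕ) (s : V → ℤ) : Prop :=
  StabilizableVia A (fun _ => False) s

def stabSeq (A : V → V → ℕ) (F : V → Prop) (s : V → ℤ) : List V :=
  if h : StabilizableVia A F s then h.choose else []

def stabilizeVia (A : V → V → ℕ) (F : V → Prop) (s : V → ℤ) : V → ℤ :=
  applySeq A s (stabSeq A F s)

/-- Odometer: number of topplings at each vertex (`0` everywhere if not stabilizable). -/
def odometerVia (A : V → V → ℕ) (F : V → Prop) (s : V → ℤ) : V → ℕ :=
  fun i => (stabSeq A F s).count i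

def sinkStabilize (A : V → V → ℕ) (z : V) (s : V → ℤ) : V → ℤ :=
  stabilizeVia A (fun i => i = z) s

def sinkOdometer (A : V → V → ℕ) (z : V) (s : V → ℤ) : V → ℕ :=
  odometerVia A (fun i => i = z) s

/-- `ρ` is `z`-recurrent (Dhar's burning test): `ρ(z) = deg z`, `ρ(i) ≤ deg i - 1`
off the sink, and every site other than `z` topples exactly once in the
stabilization of `ρ + Δδ_z` with sink `z`. -/
def ZRec (A : V → V → ℕ) (z : V) (ρ : V → ℤ) : Prop :=
  ρ z = (deg A z : ℤ) ∧ (∀ i, i ≠ z → ρ i ≤ (deg A i : ℤ) - 1) ∧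
  ∃ l : List V, StabilizesTo A (fun i => i = z) (fun j => ρ j + lap A (delta z) j) l ∧
    ∀ i, i ≠ z → l.count i = 1

/-- `κ` = number of `z`-recurrent sandpiles. -/
def kappa (A : V → V → ℕ) (z : V) : ℕ := Nat.card {ρ : V → ℤ // ZRec A z ρ}

def totalMass (s : V → ℤ) : ℤ := ∑ i, s i

/-- Open addition operator `â_i` (with sink `z`). -/
def openAdd (A : V → V → ℕ) (z i : V) (ρ : V → ℤ) : V → ℤ :=
  fun j => if j = z then (deg A z : ℤ) else sinkStabilize A z (fun k => ρ k + delta i k) j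

/-- `â_i⁻¹` on `Rec(z)`. -/
def openAddInv (A : V → V → ℕ) (z i : V) (ρ : V → ℤ) : V → ℤ :=
  if h : ∃ ρ', ZRec A z ρ' ∧ openAdd A z i ρ' = ρ then h.choose else ρ

/-- Burst size `av_{i→z}(ρ) = |â_i⁻¹ρ| - |ρ| + 1`. -/
def burst (A : V → V → ℕ) (z i : V) (ρ : V → ℤ) : ℤ :=
  totalMass (openAddInv A z i ρ) - totalMass ρ + 1

/-- The `z`-recurrent decomposition `s = ρ + m·δ_z + Δv` with `ρ ∈ Rec(z)`, `v(z)=0`. -/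
def ZDecomp (A : V → V → ℕ) (z : V) (s ρ : V → ℤ) (m : ℤ) (v : V → ℤ) : Prop :=
  ZRec A z ρ ∧ v z = 0 ∧ ∀ j, s j = ρ j + m * delta z j + lap A v j

/-- `R_z(s)`: the `z`-recurrent representative of `s`. -/
def Rz (A : V → V → ℕ) (z : V) (s : V → ℤ) : V → ℤ :=
  if h : ∃ ρ, ∃ m, ∃ v, ZDecomp A z s ρ m v then h.choose else s

/-- `m_z(s)`: the integer in the `z`-recurrent decomposition of `s`. -/
def mz (A : V → V → ℕ) (z : V) (s : V → ℤ) : ℤ :=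
  if h : ∃ m, ∃ ρ, ∃ v, ZDecomp A z s ρ m v then h.choose else 0

/-- Closed addition operator `a_i`. -/
def closedAdd (A : V → V → ℕ) (i : V) (s : V → ℤ) : V → ℤ :=
  if Stabilizable A (fun j => s j + delta i j) then
    stabilizeVia A (fun _ => False) (fun j => s j + delta i j)
  else fun j => s j + delta i j

/-- The closed chain after making the additions listed in `w` (in order). -/
def chain (A : V → V → ℕ) (s0 : V → ℤ) (w : List V) : V → ℤ :=
  w.foldl (fun s i => closedAdd A i s) s0

/-- `w` is a threshold word for `s0`: the chain first becomes non-stabilizable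
exactly after the additions in `w`, i.e. `τ = |w|` on the cylinder of `w`. -/
def IsThresholdWord (A : V → V → ℕ) (s0 : V → ℤ) (w : List V) : Prop :=
  ¬ Stabilizable A (chain A s0 w) ∧
  ∀ w' : List V, w' <+: w → w' ≠ w → Stabilizable A (chain A s0 w')

def wordProb (α : V → ℝ) (w : List V) : ℝ := (w.map α).prod

/-- `P_{s0}(E at the threshold time)`: total probability of the (disjoint)
cylinders of threshold words satisfying `E`. -/
def thresholdProb (A : V → V → ℕ) (α : V → ℝ) (s0 : V → ℤ) (E : List V → Prop) : ℝ :=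
  ∑' w : List V, if IsThresholdWord A s0 w ∧ E w then wordProb α w else 0

/-- `E_{s0}[f at the threshold time]`. -/
def thresholdExp (A : V → V → ℕ) (α : V → ℝ) (s0 : V → ℤ) (f : List V → ℝ) : ℝ :=
  ∑' w : List V, if IsThresholdWord A s0 w then wordProb α w * f w else 0

end ThresholdState

namespace ThresholdState

lemma sub_delta_nonneg {V : Type*} [DecidableEq V] {v : V → ℤ} (hv : ∀ i, 0 ≤ v i) {i : V}
    (hi : 1 ≤ v i) (j : V) : 0 ≤ v j - delta i j := by
  unfold delta
  split_ifs with h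
  · subst h; omega
  · simpa using hv j

section Laplacian

variable {V : Type*} [Fintype V] (A : V → V → ℕ)

lemma lap_add (u v : V → ℤ) (i : V) :
    lap A (fun j => u j + v j) i = lap A u i + lap A v i := by
  simp only [lap, mul_add, Finset.sum_add_distrib]
  ring

lemma lap_mul (c : ℤ) (u : V → ℤ) (i : V) :
    lap A (fun j => c * u j) i = c * lap A u i := by
  simp only [lap, mul_add, Finset.mul_sum]
  congr 1
  · ring
  · exact Finset.sum_congr rfl fun j _ => by ring

lemma lap_sub (u v : V → ℤ) (i : V) :
    lap A (fun j => u j - v j) i = lap A u i - lap A v i := by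
  simp only [lap, mul_sub, Finset.sum_sub_distrib]
  ring

lemma sum_lap (u : V → ℤ) : ∑ i, lap A u i = 0 := by
  simp only [lap, Finset.sum_add_distrib, deg, outdeg]
  rw [Finset.sum_comm]
  simp [Finset.sum_mul]

lemma lap_nonneg {u : V → ℤ} (hu : ∀ j, 0 ≤ u j) {i : V} (hi : u i = 0) : 0 ≤ lap A u i := by
  simp only [lap, hi, mul_zero, zero_add]
  exact Finset.sum_nonneg fun j _ => mul_nonneg (Int.natCast_nonneg _) (hu j)

variable {A}

lemma Eulerian.lap_eq (hE : Eulerian A) (u : V → ℤ) (i : V) :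
    lap A u i = ∑ j, (A j i : ℤ) * (u j - u i) := by
  have h : (deg A i : ℤ) = ∑ j, (A j i : ℤ) := by
    rw [deg, hE i, indeg]; push_cast; rfl
  simp only [lap, h, mul_sub, Finset.sum_sub_distrib, ← Finset.sum_mul]
  ring

lemma Eulerian.lap_const (hE : Eulerian A) (c : ℤ) (i : V) : lap A (fun _ => c) i = 0 := by
  simp [hE.lap_eq]

/-- A vertex that is unstable in `s` but stable in `s + Δv`, with `v ≥ 0`, has `v > 0`. -/
lemma one_le_of_unstable {s v : V → ℤ} (hv : ∀ i, 0 ≤ v i) {i : V}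
    (hst : s i + lap A v i ≤ (deg A i : ℤ) - 1) (hi : (deg A i : ℤ) ≤ s i) : 1 ≤ v i := by
  by_contra hc
  have := lap_nonneg A hv (i := i) (by have := hv i; omega)
  omega

end Laplacian

section Toppling

variable {V : Type*} [Fintype V] [DecidableEq V] {A : V → V → ℕ} {F : V → Prop}

lemma applySeq_apply (s : V → ℤ) (l : List V) (j : V) :
    applySeq A s l j = s j + lap A (fun k => (l.count k : ℤ)) j := by
  induction l generalizing s with
  | nil => simp [applySeq, lap]
  | cons i l ih =>
    have h : (fun k => ((i :: l).count k : ℤ)) = fun k => delta i k + (l.count k : ℤ) := by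
      funext k
      rw [List.count_cons]
      by_cases hk : k = i
      · subst hk; simp [delta, add_comm]
      · simp [delta, hk, Ne.symm hk]
    rw [h, lap_add, ← add_assoc]
    exact ih (toppleAt A s i)

lemma applySeq_append (s : V → ℤ) (l l' : List V) :
    applySeq A s (l ++ l') = applySeq A (applySeq A s l) l' := List.foldl_append

lemma validSeq_append {s : V → ℤ} {l l' : List V} :
    ValidSeq A F s (l ++ l') ↔ ValidSeq A F s l ∧ ValidSeq A F (applySeq A s l) l' := by
  induction l generalizing s with
  | nil => simp [ValidSeq, applySeq]
  | cons i l ih =>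
    simp only [List.cons_append, ValidSeq, ih, and_assoc]
    rfl

lemma ValidSeq.mono {s s' : V → ℤ} {l : List V} (h : ∀ i, ¬ F i → s i ≤ s' i)
    (hl : ValidSeq A F s l) : ValidSeq A F s' l := by
  induction l generalizing s s' with
  | nil => trivial
  | cons i l ih =>
    obtain ⟨h1, h2, h3⟩ := hl
    exact ⟨h1, h2.trans (h i h1), ih (fun j hj => by simpa [toppleAt] using h j hj) h3⟩

lemma ValidSeq.count_eq_zero {s : V → ℤ} {l : List V} (hl : ValidSeq A F s l) {i : V} (hi : F i) :
    l.count i = 0 := by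
  induction l generalizing s with
  | nil => rfl
  | cons j l ih =>
    obtain ⟨h1, -, h3⟩ := hl
    have : j ≠ i := fun h => h1 (h ▸ hi)
    rw [List.count_cons_of_ne this, ih h3]

lemma toppleAt_add_lap_sub (s v : V → ℤ) (i j : V) :
    toppleAt A s i j + lap A (fun k => v k - delta i k) j = s j + lap A v j := by
  rw [lap_sub, toppleAt]; ring

/-- The least action principle. -/
lemma ValidSeq.count_le {s v : V → ℤ} {l : List V} (hl : ValidSeq A F s l) (hv : ∀ i, 0 ≤ v i)
    (hst : ∀ i, ¬ F i → s i + lap A v i ≤ (deg A i : ℤ) - 1) (i : V) : (l.count i : ℤ) ≤ v i := by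
  induction l generalizing s v with
  | nil => simpa using hv i
  | cons j l ih =>
    obtain ⟨h1, h2, h3⟩ := hl
    have hj := one_le_of_unstable hv (hst j h1) h2
    have := ih h3 (sub_delta_nonneg hv hj)
      (fun k hk => by rw [toppleAt_add_lap_sub]; exact hst k hk)
    rw [List.count_cons]
    by_cases hij : i = j
    · subst hij; simp [delta] at this ⊢; omega
    · simpa [delta, hij, Ne.symm hij] using this

lemma stabilizableVia_of_stable {s v : V → ℤ} (hv : ∀ i, 0 ≤ v i)
    (hst : ∀ i, ¬ F i → s i + lap A v i ≤ (deg A i : ℤ) - 1) : StabilizableVia A F s := by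
  obtain ⟨n, hn⟩ : ∃ n : ℕ, ∑ i, v i = n :=
    ⟨_, (Int.toNat_of_nonneg (Finset.sum_nonneg fun i _ => hv i)).symm⟩
  induction n generalizing s v with
  | zero =>
    have h0 : ∀ i, v i = 0 := fun i =>
      (Finset.sum_eq_zero_iff_of_nonneg fun i _ => hv i).1 (by simpa using hn) i (Finset.mem_univ i)
    exact ⟨[], trivial, fun i hi => by simpa [applySeq, lap, h0] using hst i hi⟩
  | succ n ih =>
    by_cases hs : StableOff A F s
    · exact ⟨[], trivial, hs⟩
    · unfold StableOff at hs
      push Not at hs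
      obtain ⟨i, hi, hsi⟩ := hs
      have hsi' : (deg A i : ℤ) ≤ s i := by omega
      have hvi := one_le_of_unstable hv (hst i hi) hsi'
      obtain ⟨l, hl, hl'⟩ := ih (sub_delta_nonneg hv hvi)
        (fun k hk => by rw [toppleAt_add_lap_sub]; exact hst k hk)
        (by rw [Finset.sum_sub_distrib, hn]; simp [delta])
      exact ⟨i :: l, ⟨hi, hsi', hl⟩, hl'⟩

lemma StabilizesTo.count_eq {s : V → ℤ} {l l' : List V} (h : StabilizesTo A F s l)
    (h' : StabilizesTo A F s l') (i : V) : l.count i = l'.count i := by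
  have key : ∀ {l l' : List V}, StabilizesTo A F s l → StabilizesTo A F s l' →
      (l.count i : ℤ) ≤ l'.count i := fun h h' =>
    h.1.count_le (v := fun k => (List.count k _ : ℤ)) (fun j => Int.natCast_nonneg _)
      (fun j hj => by rw [← applySeq_apply]; exact h'.2 j hj) i
  have h1 := key h h'
  have h2 := key h' h
  omega

lemma stabSeq_spec {s : V → ℤ} (h : StabilizableVia A F s) :
    StabilizesTo A F s (stabSeq A F s) := by
  rw [stabSeq, dif_pos h]
  exact h.choose_spec

end Toppling

section Sink

lemma Connected.exists_rank {V : Type*} {A : V → V → ℕ} (hC : Connected A) (z : V) :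
    ∃ d : V → ℕ, ∀ i, i ≠ z → ∃ j, 0 < A j i ∧ d j < d i := by
  let P : ℕ → V → Prop := fun n => Nat.rec (motive := fun _ => V → Prop) (fun i => i = z)
    (fun _ p i => ∃ j, 0 < A j i ∧ p j) n
  have hP : ∀ i, ∃ n, P n i := fun i => by
    induction hC z i with
    | refl => exact ⟨0, rfl⟩
    | tail _ h ih =>
      obtain ⟨n, hn⟩ := ih
      exact ⟨n + 1, _, h, hn⟩
  refine ⟨fun i => Nat.find (hP i), fun i hi => ?_⟩
  have hs := Nat.find_spec (hP i)
  cases hn : Nat.find (hP i) with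
  | zero => rw [hn] at hs; exact absurd hs hi
  | succ n =>
    rw [hn] at hs
    obtain ⟨j, hj, hj'⟩ := hs
    refine ⟨j, hj, ?_⟩
    change Nat.find (hP j) < Nat.find (hP i)
    rw [hn]
    exact Nat.lt_succ_of_le (Nat.find_min' (hP j) hj')

variable {V : Type*} [Fintype V] [DecidableEq V] {A : V → V → ℕ}

/-- A nonnegative function that is strictly superharmonic off `z`. -/
lemma exists_superharmonic (hE : Eulerian A) (hC : Connected A) (z : V) :
    ∃ w : V → ℤ, (∀ i, 0 ≤ w i) ∧ ∀ i, i ≠ z → lap A w i ≤ -1 := by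
  obtain ⟨d, hd⟩ := hC.exists_rank z
  let D := ∑ i, d i
  let C := ∑ i, deg A i + 1
  have hdD : ∀ i, d i ≤ D := fun i => Finset.single_le_sum (by simp) (Finset.mem_univ i)
  have hCpos : 1 ≤ C := Nat.le_add_left _ _
  refine ⟨fun i => (C : ℤ) ^ D - (C : ℤ) ^ (D - d i), fun i => ?_, fun i hi => ?_⟩
  · exact sub_nonneg.2 (pow_le_pow_right₀ (by exact_mod_cast hCpos) (Nat.sub_le _ _))
  · obtain ⟨j, hj, hji⟩ := hd i hi
    rw [hE.lap_eq]
    set X : ℤ := (C : ℤ) ^ (D - d i) with hX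
    have hX1 : 1 ≤ X := one_le_pow₀ (by exact_mod_cast hCpos)
    have hterm : ∀ k, (A k i : ℤ) * ((C : ℤ) ^ D - (C : ℤ) ^ (D - d k) - ((C : ℤ) ^ D - X)) ≤
        A k i * X - if k = j then C * X else 0 := by
      intro k
      have hk0 : 0 ≤ (C : ℤ) ^ (D - d k) := by positivity
      have hA : (0 : ℤ) ≤ A k i := Int.natCast_nonneg _
      split_ifs with hk
      · subst hk
        have h1 : C * X ≤ (C : ℤ) ^ (D - d k) := by
          rw [hX, ← pow_succ']
          refine pow_le_pow_right₀ (by exact_mod_cast hCpos) ?_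
          have := hdD i
          omega
        have h2 : (1 : ℤ) ≤ A k i := by exact_mod_cast hj
        nlinarith
      · nlinarith
    refine (Finset.sum_le_sum fun k _ => hterm k).trans ?_
    rw [Finset.sum_sub_distrib, ← Finset.sum_mul, Finset.sum_ite_eq' Finset.univ j,
      if_pos (Finset.mem_univ j)]
    have hdeg : (∑ k, (A k i : ℤ)) = deg A i := by rw [deg, hE i, indeg]; push_cast; rfl
    have hle : (deg A i : ℤ) + 1 ≤ C := by
      have : deg A i ≤ ∑ i, deg A i :=
        Finset.single_le_sum (f := fun i => deg A i) (by simp) (Finset.mem_univ i)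
      simp only [C]; omega
    rw [hdeg]
    nlinarith

lemma exists_superharmonic_lap_le (hE : Eulerian A) (hC : Connected A) (z : V) (s : V → ℤ) :
    ∃ v : V → ℤ, (∀ i, 0 ≤ v i) ∧ ∀ i, i ≠ z → s i + lap A v i ≤ -1 := by
  obtain ⟨w, hw, hw'⟩ := exists_superharmonic hE hC z
  have hN : 0 ≤ ∑ i, |s i| := Finset.sum_nonneg fun i _ => abs_nonneg _
  refine ⟨fun i => (∑ i, |s i| + 1) * w i, fun i => mul_nonneg (by omega) (hw i), fun i hi => ?_⟩
  rw [lap_mul]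
  have h1 : |s i| ≤ ∑ i, |s i| :=
    Finset.single_le_sum (f := fun i => |s i|) (fun _ _ => abs_nonneg _) (Finset.mem_univ i)
  have h2 := le_abs_self (s i)
  nlinarith [hw' i hi]

lemma stabilizableVia_sink (hE : Eulerian A) (hC : Connected A) (z : V) (s : V → ℤ) :
    StabilizableVia A (fun i => i = z) s := by
  obtain ⟨v, hv, hv'⟩ := exists_superharmonic_lap_le hE hC z s
  exact stabilizableVia_of_stable hv fun i hi => by have := hv' i hi; omega

end Sink

section Recurrent

variable {V : Type*} [Fintype V] [DecidableEq V] {A : V → V → ℕ} {z : V}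

/-- A nonempty set `U` avoiding the sink is not a forbidden subconfiguration of a
recurrent sandpile: some vertex of `U` topples after receiving chips only from outside `U`. -/
lemma ZRec.exists_deg_le {ρ : V → ℤ} (hρ : ZRec A z ρ) {U : V → Prop} [DecidablePred U]
    (hz : ¬ U z) (hU : ∃ i, U i) :
    ∃ i, U i ∧ (deg A i : ℤ) ≤ ρ i + ∑ j, (A j i : ℤ) * if U j then 0 else 1 := by
  obtain ⟨-, -, l, ⟨hl, -⟩, hcount⟩ := hρ
  have hfirst : ∀ l : List V, (∃ i ∈ l, U i) →
      ∃ l₁ i l₂, l = l₁ ++ i :: l₂ ∧ U i ∧ ∀ j ∈ l₁, ¬ U j := by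
    intro l
    induction l with
    | nil => simp
    | cons a l ih =>
      intro h
      by_cases ha : U a
      · exact ⟨[], a, l, rfl, ha, by simp⟩
      · obtain ⟨l₁, i, l₂, h1, h2, h3⟩ := ih (by simpa [ha] using h)
        exact ⟨a :: l₁, i, l₂, by simp [h1], h2, by simpa [ha] using h3⟩
  obtain ⟨i₀, hi₀⟩ := hU
  have hmem : i₀ ∈ l := by
    rw [← List.count_pos_iff, hcount i₀ (fun h => hz (h ▸ hi₀))]
    exact one_pos
  obtain ⟨l₁, i, l₂, rfl, hi, hl₁⟩ := hfirst l ⟨i₀, hmem, hi₀⟩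
  have hiz : i ≠ z := fun h => hz (h ▸ hi)
  rw [validSeq_append] at hl
  have hunst : (deg A i : ℤ) ≤ applySeq A (fun j => ρ j + lap A (delta z) j) l₁ i := hl.2.2.1
  refine ⟨i, hi, hunst.trans ?_⟩
  have hc0 : l₁.count i = 0 := List.count_eq_zero_of_not_mem fun h => hl₁ i h hi
  rw [applySeq_apply, add_assoc, ← lap_add]
  simp only [lap, hc0, delta, hiz, if_false, Nat.cast_zero, add_zero, mul_zero, zero_add]
  gcongr with j
  split_ifs with hjz hjU hjU
  · exact absurd (hjz ▸ hjU) hz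
  · have := hl.1.count_eq_zero (i := j) hjz
    omega
  · have := List.count_eq_zero_of_not_mem fun h => hl₁ j h hjU
    omega
  · have := hcount j hjz
    rw [List.count_append] at this
    omega

lemma ZRec.nonneg (hE : Eulerian A) {ρ : V → ℤ} (hρ : ZRec A z ρ) (i : V) : 0 ≤ ρ i := by
  by_cases hi : i = z
  · rw [hi, hρ.1]; exact Int.natCast_nonneg _
  · obtain ⟨k, rfl, hk⟩ := hρ.exists_deg_le (U := fun j => j = i) (Ne.symm hi) ⟨i, rfl⟩
    have : ∑ j, (A j k : ℤ) * (if j = k then 0 else 1) ≤ ∑ j, (A j k : ℤ) :=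
      Finset.sum_le_sum fun j _ => by split_ifs <;> simp
    have hdeg : (∑ j, (A j k : ℤ)) = deg A k := by rw [deg, hE k, indeg]; push_cast; rfl
    omega

/-- If a recurrent sandpile is obtained off the sink from a stable one by adding `Δw`, then
`w` is maximal at the sink. -/
lemma ZRec.le_sink (hE : Eulerian A) {ρ t w : V → ℤ} (hρ : ZRec A z ρ)
    (ht : ∀ i, i ≠ z → t i ≤ (deg A i : ℤ) - 1) (h : ∀ i, i ≠ z → ρ i = t i + lap A w i) (i : V) :
    w i ≤ w z := by
  obtain ⟨m, -, hm⟩ := Finset.exists_max_image Finset.univ w ⟨z, Finset.mem_univ z⟩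
  refine (hm i (Finset.mem_univ i)).trans ?_
  by_contra! hlt
  obtain ⟨k, hk, hdeg⟩ := hρ.exists_deg_le (U := fun j => w j = w m) hlt.ne ⟨m, rfl⟩
  have hkz : k ≠ z := fun h => hlt.ne (h ▸ hk)
  have h1 : lap A w k ≤ -∑ j, (A j k : ℤ) * (if w j = w m then 0 else 1) := by
    rw [hE.lap_eq, ← Finset.sum_neg_distrib]
    refine Finset.sum_le_sum fun j _ => ?_
    have hA : (0 : ℤ) ≤ A j k := Int.natCast_nonneg _
    have hj := hm j (Finset.mem_univ j)
    split_ifs with hjm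
    · simp [hjm, hk]
    · have : w j < w m := lt_of_le_of_ne hj hjm
      rw [hk]
      nlinarith
  have := h k hkz
  have := ht k hkz
  omega

/-- The recurrent decomposition, without the normalization `v(z) = 0`. -/
def HasDecomp (A : V → V → ℕ) (z : V) (s ρ : V → ℤ) (m : ℤ) : Prop :=
  ZRec A z ρ ∧ ∃ v : V → ℤ, ∀ j, s j = ρ j + m * delta z j + lap A v j

lemma ZRec.hasDecomp {ρ : V → ℤ} (hρ : ZRec A z ρ) : HasDecomp A z ρ ρ 0 :=
  ⟨hρ, fun _ => 0, fun j => by simp [lap]⟩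

lemma HasDecomp.unique (hE : Eulerian A) {s ρ ρ' : V → ℤ} {m m' : ℤ} (h : HasDecomp A z s ρ m)
    (h' : HasDecomp A z s ρ' m') : ρ = ρ' := by
  obtain ⟨hρ, v, hv⟩ := h
  obtain ⟨hρ', v', hv'⟩ := h'
  have heq : ∀ i, i ≠ z → ρ i + lap A v i = ρ' i + lap A v' i := fun i hi => by
    have h1 := hv i
    rw [hv' i] at h1
    simp only [delta, hi, if_false, mul_zero, add_zero] at h1
    exact h1.symm
  have hle := hρ.le_sink hE hρ'.2.1 (w := fun j => v' j - v j)
    (fun i hi => by rw [lap_sub]; have := heq i hi; omega)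
  have hge := hρ'.le_sink hE hρ.2.1 (w := fun j => v j - v' j)
    (fun i hi => by rw [lap_sub]; have := heq i hi; omega)
  funext i
  by_cases hi : i = z
  · rw [hi, hρ.1, hρ'.1]
  · have hconst : (fun j => v j - v' j) = fun _ => v z - v' z := by
      funext j
      have h1 := hle j
      have h2 := hge j
      omega
    have h0 : lap A v i - lap A v' i = 0 := by rw [← lap_sub, hconst, hE.lap_const]
    have := heq i hi
    omega

lemma HasDecomp.totalMass_eq {s ρ : V → ℤ} {m : ℤ} (h : HasDecomp A z s ρ m) :
    totalMass s = totalMass ρ + m := by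
  obtain ⟨-, v, hv⟩ := h
  simp only [totalMass, hv, Finset.sum_add_distrib, sum_lap, ← Finset.mul_sum]
  simp [delta]

lemma HasDecomp.zDecomp (hE : Eulerian A) {s ρ : V → ℤ} {m : ℤ} (h : HasDecomp A z s ρ m) :
    ∃ v, ZDecomp A z s ρ m v := by
  obtain ⟨hρ, v, hv⟩ := h
  exact ⟨fun j => v j - v z, hρ, by simp,
    fun j => by rw [lap_sub, hE.lap_const, sub_zero]; exact hv j⟩

lemma HasDecomp.rz_eq (hE : Eulerian A) {s ρ : V → ℤ} {m : ℤ} (h : HasDecomp A z s ρ m) :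
    Rz A z s = ρ := by
  have hex : ∃ ρ, ∃ m, ∃ v, ZDecomp A z s ρ m v := ⟨ρ, m, h.zDecomp hE⟩
  rw [Rz, dif_pos hex]
  obtain ⟨m', v', h1, -, h2⟩ := hex.choose_spec
  exact HasDecomp.unique hE ⟨h1, v', h2⟩ h

lemma HasDecomp.stabilizable_iff (hE : Eulerian A) {s ρ : V → ℤ} {m : ℤ}
    (h : HasDecomp A z s ρ m) : Stabilizable A s ↔ m < 0 := by
  obtain ⟨hρ, v, hv⟩ := h
  constructor
  · rintro ⟨l, -, hl⟩
    by_contra! hm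
    have ht : ∀ i, applySeq A s l i ≤ (deg A i : ℤ) - 1 := fun i => hl i not_false
    have hle := hρ.le_sink hE (t := applySeq A s l) (fun i _ => ht i)
      (w := fun j => 0 - (v j + (l.count j : ℤ))) (fun i hi => by
        rw [applySeq_apply, hv, lap_sub, lap_add, hE.lap_const]
        simp only [delta, hi, if_false]
        ring)
    have hneg : lap A (fun j => 0 - (v j + (l.count j : ℤ))) z ≤ 0 := by
      rw [hE.lap_eq]
      exact Finset.sum_nonpos fun j _ => mul_nonpos_of_nonneg_of_nonpos
        (Int.natCast_nonneg _) (sub_nonpos.2 (hle j))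
    have h1 := ht z
    rw [applySeq_apply, hv, hρ.1] at h1
    rw [lap_sub, lap_add, hE.lap_const] at hneg
    simp only [delta, if_true] at h1
    omega
  · intro hm
    refine stabilizableVia_of_stable (v := fun j => ∑ i, |v i| - v j) (fun j => ?_) fun i _ => ?_
    · have h1 : |v j| ≤ ∑ i, |v i| :=
        Finset.single_le_sum (f := fun i => |v i|) (fun _ _ => abs_nonneg _) (Finset.mem_univ j)
      have h2 := le_abs_self (v j)
      omega
    · rw [lap_sub, hE.lap_const, hv]
      by_cases hi : i = z
      · subst hi
        rw [hρ.1]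
        simp only [delta, if_true]
        omega
      · have := hρ.2.1 i hi
        simp only [delta, hi, if_false]
        omega

end Recurrent

section OpenAdd

variable {V : Type*} [Fintype V] [DecidableEq V] {A : V → V → ℕ} {z : V}

lemma HasDecomp.congr {s s' ρ : V → ℤ} {m : ℤ} (h : HasDecomp A z s ρ m) (c : ℤ) (u : V → ℤ)
    (hs : ∀ j, s' j = s j + c * delta z j + lap A u j) : HasDecomp A z s' ρ (m + c) := by
  obtain ⟨hρ, v, hv⟩ := h
  exact ⟨hρ, fun j => v j + u j, fun j => by rw [hs, hv, lap_add]; ring⟩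

/-- The change of the `δ_z` coefficient caused by adding a chip at `i`. -/
def burstOut (A : V → V → ℕ) (z i : V) (ρ : V → ℤ) : ℤ :=
  totalMass ρ - totalMass (openAdd A z i ρ) + 1

lemma openAdd_spec (hE : Eulerian A) (hC : Connected A) {ρ : V → ℤ} (hρ : ZRec A z ρ) (i : V) :
    HasDecomp A z (fun j => ρ j + delta i j) (openAdd A z i ρ) (burstOut A z i ρ) ∧
      0 ≤ burstOut A z i ρ := by
  set F : V → Prop := fun k => k = z
  set s : V → ℤ := fun j => ρ j + delta i j with hs
  set l := stabSeq A F s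
  obtain ⟨hl, hst⟩ : StabilizesTo A F s l := stabSeq_spec (stabilizableVia_sink hE hC z s)
  have hopen : ∀ j, openAdd A z i ρ j = if j = z then (deg A z : ℤ) else applySeq A s l j :=
    fun j => rfl
  have hρ' := hρ
  obtain ⟨hρz, hρst, b, ⟨hb, -⟩, hbc⟩ := hρ
  have hz0 : l.count z = 0 := hl.count_eq_zero rfl
  have hbz : b.count z = 0 := hb.count_eq_zero rfl
  have hδ : ∀ j, 0 ≤ delta i j := fun j => by unfold delta; split_ifs <;> simp
  have hlap : ∀ j, j ≠ z → 0 ≤ lap A (delta z) j := fun j hj =>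
    lap_nonneg A (fun k => by unfold delta; split_ifs <;> simp) (by simp [delta, hj])
  set t : V → ℤ := fun j => s j + lap A (delta z) j with ht
  have hb1 : (fun k => delta z k + (b.count k : ℤ)) = fun _ => 1 := by
    funext k
    by_cases hk : k = z
    · subst hk; simp [delta, hbz]
    · simp [delta, hk, hbc k hk]
  have hbapp : applySeq A t b = s := by
    funext j
    rw [applySeq_apply, ht]
    simp only
    rw [add_assoc, ← lap_add, hb1, hE.lap_const, add_zero]
  have htb : StabilizesTo A F t (b ++ l) := by
    refine ⟨validSeq_append.2 ⟨hb.mono fun j _ => ?_, ?_⟩, ?_⟩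
    · simp only [ht, hs]
      have := hδ j
      omega
    · rw [hbapp]; exact hl
    · rw [applySeq_append, hbapp]; exact hst
  obtain ⟨l', hl'⟩ := stabilizableVia_sink hE hC z (applySeq A t l)
  have htl : StabilizesTo A F t (l ++ l') :=
    ⟨validSeq_append.2 ⟨hl.mono fun j hj => by
      simp only [ht]
      have := hlap j hj
      omega, hl'.1⟩, by rw [applySeq_append]; exact hl'.2⟩
  have hcount : ∀ j, b.count j = l'.count j := fun j => by
    have := htb.count_eq htl j
    simp only [List.count_append] at this
    omega
  have hoff : ∀ j, ¬ F j → applySeq A t l j = openAdd A z i ρ j + lap A (delta z) j := by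
    intro j hj
    rw [hopen, if_neg hj, applySeq_apply, applySeq_apply]
    simp only [ht]
    ring
  have hrec : ZRec A z (openAdd A z i ρ) := by
    refine ⟨by simp [hopen], fun j hj => by rw [hopen, if_neg hj]; exact hst j hj, l',
      ⟨hl'.1.mono fun j hj => (hoff j hj).le, fun j hj => ?_⟩,
      fun j hj => by rw [← hcount, hbc j hj]⟩
    have h1 := hl'.2 j hj
    rw [applySeq_apply, hoff j hj] at h1
    rw [applySeq_apply]
    exact h1
  have hdec : HasDecomp A z s (openAdd A z i ρ) (applySeq A s l z - deg A z) := by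
    refine ⟨hrec, fun k => 0 - (l.count k : ℤ), fun j => ?_⟩
    rw [lap_sub, hE.lap_const, hopen]
    by_cases hj : j = z
    · subst hj
      rw [if_pos rfl, applySeq_apply]
      simp only [delta, if_true]
      ring
    · rw [if_neg hj, applySeq_apply]
      simp only [delta, hj, if_false]
      ring
  have hmass := hdec.totalMass_eq
  have hs1 : totalMass s = totalMass ρ + 1 := by
    simp [totalMass, hs, Finset.sum_add_distrib, delta]
  have hm : burstOut A z i ρ = applySeq A s l z - deg A z := by
    rw [burstOut]
    omega
  rw [hm]
  refine ⟨hdec, ?_⟩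
  have h1 := lap_nonneg A (u := fun k => (l.count k : ℤ)) (fun k => Int.natCast_nonneg _) (i := z)
    (by simp [hz0])
  have h2 := hδ z
  rw [applySeq_apply, hs]
  simp only [hρz]
  omega

lemma ZRec.openAdd (hE : Eulerian A) (hC : Connected A) {ρ : V → ℤ} (hρ : ZRec A z ρ) (i : V) :
    ZRec A z (openAdd A z i ρ) := (openAdd_spec hE hC hρ i).1.1

lemma burstOut_nonneg (hE : Eulerian A) (hC : Connected A) {ρ : V → ℤ} (hρ : ZRec A z ρ) (i : V) :
    0 ≤ burstOut A z i ρ := (openAdd_spec hE hC hρ i).2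

lemma openAdd_injective (hE : Eulerian A) (hC : Connected A) {ρ ρ' : V → ℤ} (hρ : ZRec A z ρ)
    (hρ' : ZRec A z ρ') {i : V} (h : openAdd A z i ρ = openAdd A z i ρ') : ρ = ρ' := by
  obtain ⟨⟨-, v, hv⟩, -⟩ := openAdd_spec hE hC hρ i
  obtain ⟨⟨-, v', hv'⟩, -⟩ := openAdd_spec hE hC hρ' i
  refine hρ.hasDecomp.unique hE (hρ'.hasDecomp.congr (burstOut A z i ρ - burstOut A z i ρ')
    (fun j => v j - v' j) fun j => ?_)
  have h1 := hv j
  have h2 := hv' j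
  rw [h] at h1
  rw [lap_sub]
  linear_combination h1 - h2

lemma openAdd_sink (hE : Eulerian A) (hC : Connected A) {ρ : V → ℤ} (hρ : ZRec A z ρ) :
    openAdd A z z ρ = ρ :=
  (openAdd_spec hE hC hρ z).1.unique hE
    (hρ.hasDecomp.congr 1 (fun _ => 0) fun j => by rw [hE.lap_const]; ring)

lemma burst_openAdd (hE : Eulerian A) (hC : Connected A) {ρ : V → ℤ} (hρ : ZRec A z ρ) (i : V) :
    burst A z i (openAdd A z i ρ) = burstOut A z i ρ := by
  have hex : ∃ ρ', ZRec A z ρ' ∧ openAdd A z i ρ' = openAdd A z i ρ := ⟨ρ, hρ, rfl⟩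
  have : openAddInv A z i (openAdd A z i ρ) = ρ := by
    rw [openAddInv, dif_pos hex]
    exact openAdd_injective hE hC hex.choose_spec.1 hρ hex.choose_spec.2
  rw [burst, this, burstOut]

lemma HasDecomp.closedAdd (hE : Eulerian A) (hC : Connected A) {s ρ : V → ℤ} {m : ℤ}
    (h : HasDecomp A z s ρ m) (i : V) :
    HasDecomp A z (closedAdd A i s) (openAdd A z i ρ) (m + burstOut A z i ρ) := by
  obtain ⟨u, hu⟩ : ∃ u : V → ℤ, ∀ j, ThresholdState.closedAdd A i s j =
      s j + delta i j + lap A u j := by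
    unfold ThresholdState.closedAdd
    split_ifs
    · exact ⟨_, fun j => applySeq_apply _ _ j⟩
    · exact ⟨fun _ => 0, fun j => by rw [hE.lap_const, add_zero]⟩
  obtain ⟨hρ, v, hv⟩ := h
  rw [add_comm]
  refine (openAdd_spec hE hC hρ i).1.congr m (fun j => v j + u j) fun j => ?_
  rw [hu, hv, lap_add]
  ring

lemma exists_hasDecomp_foldl (hE : Eulerian A) (hC : Connected A) {ρ : V → ℤ} (hρ : ZRec A z ρ)
    (w : List V) : ∃ m, HasDecomp A z (fun j => ρ j + (w.count j : ℤ))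
      (w.foldl (fun η i => openAdd A z i η) ρ) m := by
  induction w generalizing ρ with
  | nil => exact ⟨0, by simpa using hρ.hasDecomp⟩
  | cons i w ih =>
    obtain ⟨m, hm⟩ := ih (hρ.openAdd hE hC i)
    obtain ⟨⟨-, v, hv⟩, -⟩ := openAdd_spec hE hC hρ i
    refine ⟨_, hm.congr (burstOut A z i ρ) v fun j => ?_⟩
    have h1 := hv j
    simp only at h1 ⊢
    rw [List.count_cons]
    by_cases hj : j = i
    · subst hj
      simp only [delta, if_true, beq_self_eq_true] at h1 ⊢
      push_cast
      linear_combination h1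
    · simp only [delta, hj, if_false] at h1
      simp only [beq_iff_eq, Ne.symm hj, if_false]
      push_cast
      simp only [delta]
      linear_combination h1

/-- Every sandpile is equivalent to one reached from a given recurrent sandpile. -/
lemma exists_word_hasDecomp (hE : Eulerian A) (hC : Connected A) {ρ : V → ℤ} (hρ : ZRec A z ρ)
    (s : V → ℤ) : ∃ (w : List V) (m : ℤ),
      HasDecomp A z s (w.foldl (fun η i => openAdd A z i η) ρ) m := by
  obtain ⟨v, -, hv⟩ := exists_superharmonic_lap_le hE hC z (fun j => ρ j - s j)
  let c : V → ℕ := fun i => if i = z then 0 else (s i - ρ i - lap A v i).toNat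
  let w : List V := Finset.univ.toList.flatMap fun i => List.replicate (c i) i
  have hw : ∀ j, w.count j = c j := by
    intro j
    simp only [w, List.count_flatMap, Function.comp_def, List.count_replicate, beq_iff_eq]
    rw [Finset.sum_map_toList]
    simp
  obtain ⟨m, hm⟩ := exists_hasDecomp_foldl hE hC hρ w
  refine ⟨w, _, hm.congr (s z - ρ z - lap A v z) v fun j => ?_⟩
  simp only [hw, c]
  by_cases hj : j = z
  · subst hj
    simp only [delta, if_true, Nat.cast_zero]
    ring
  · have := hv j hj
    simp only [hj, if_false, delta]
    rw [Int.toNat_of_nonneg (by omega)]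
    ring

/-- The maximal stable sandpile is recurrent. -/
lemma exists_zRec (hE : Eulerian A) (hC : Connected A) (z : V) : ∃ ρ, ZRec A z ρ := by
  let ρ : V → ℤ := fun j => if j = z then (deg A z : ℤ) else (deg A j : ℤ) - 1
  have hρ : ∀ j, j ≠ z → ρ j = (deg A j : ℤ) - 1 := fun j hj => if_neg hj
  obtain ⟨l, hl⟩ := stabilizableVia_sink hE hC z (fun j => ρ j + lap A (delta z) j)
  refine ⟨ρ, if_pos rfl, fun j hj => (hρ j hj).le, l, hl, ?_⟩
  have hz0 : l.count z = 0 := hl.1.count_eq_zero rfl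
  have hle : ∀ j, l.count j ≤ 1 := fun j => by
    have := hl.1.count_le (v := fun j => 1 - delta z j)
      (fun j => by unfold delta; split_ifs <;> simp)
      (fun j hj => by rw [lap_sub, hE.lap_const, hρ j hj]; omega) j
    unfold delta at this
    split_ifs at this <;> omega
  obtain ⟨d, hd⟩ := hC.exists_rank z
  suffices h : ∀ n i, d i = n → i ≠ z → l.count i = 1 from fun i hi => h _ i rfl hi
  intro n
  induction n using Nat.strong_induction_on with
  | _ n ih =>
    intro i hn hi
    obtain ⟨j, hj, hji⟩ := hd i hi
    by_contra hc
    have hc0 : l.count i = 0 := by have := hle i; omega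
    have hst := hl.2 i hi
    rw [applySeq_apply, add_assoc, ← lap_add, hρ i hi] at hst
    have hpos : 0 < lap A (fun k => delta z k + (l.count k : ℤ)) i := by
      have hk : ∀ k, 0 ≤ delta z k + (l.count k : ℤ) := fun k => by
        unfold delta; split_ifs <;> omega
      have hj1 : 1 ≤ delta z j + (l.count j : ℤ) := by
        by_cases hjz : j = z
        · simp [delta, hjz]
        · simp [delta, hjz, ih (d j) (hn ▸ hji) j rfl hjz]
      simp only [lap, delta, hi, hc0, if_false, Nat.cast_zero, add_zero, mul_zero, zero_add]
      refine Finset.sum_pos' (fun k _ => mul_nonneg (Int.natCast_nonneg _) (hk k))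
        ⟨j, Finset.mem_univ j, mul_pos (by exact_mod_cast hj) ?_⟩
      exact hj1
    omega

lemma exists_hasDecomp (hE : Eulerian A) (hC : Connected A) (z : V) (s : V → ℤ) :
    ∃ ρ m, HasDecomp A z s ρ m := by
  obtain ⟨ρ, hρ⟩ := exists_zRec hE hC z
  obtain ⟨w, m, h⟩ := exists_word_hasDecomp hE hC hρ s
  exact ⟨_, m, h⟩

lemma finite_zRec (hE : Eulerian A) : Finite {ρ : V → ℤ // ZRec A z ρ} := by
  refine Set.Finite.to_subtype ((Set.Finite.pi' fun i => Set.finite_Icc 0 (deg A i : ℤ)).subset ?_)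
  intro ρ (hρ : ZRec A z ρ) i
  refine ⟨hρ.nonneg hE i, ?_⟩
  by_cases hi : i = z
  · rw [hi, hρ.1]
  · have := hρ.2.1 i hi
    omega

end OpenAdd

section Words

lemma wordProb_pos {V : Type*} {α : V → ℝ} (hα : ∀ i, 0 < α i) (w : List V) : 0 < wordProb α w :=
  List.prod_pos fun x hx => by
    obtain ⟨i, -, rfl⟩ := List.mem_map.1 hx
    exact hα i

variable {V : Type*} [Fintype V] [DecidableEq V]

/-- The words of length `n`. -/
def words (V : Type*) [Fintype V] [DecidableEq V] : ℕ → Finset (List V)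
  | 0 => {[]}
  | n + 1 => (words V n ×ˢ Finset.univ).image fun p => p.1 ++ [p.2]

lemma mem_words {n : ℕ} {w : List V} : w ∈ words V n ↔ w.length = n := by
  induction n generalizing w with
  | zero => simp [words]
  | succ n ih =>
    simp only [words, Finset.mem_image, Finset.mem_product, Finset.mem_univ, and_true, ih]
    constructor
    · rintro ⟨p, hp, rfl⟩
      simp [hp]
    · intro hw
      have hne : w ≠ [] := List.ne_nil_of_length_eq_add_one hw
      exact ⟨(w.dropLast, w.getLast hne), by simp [hw], List.dropLast_append_getLast hne⟩

lemma sum_words_succ (n : ℕ) (g : List V → ℝ) :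
    ∑ w ∈ words V (n + 1), g w = ∑ w ∈ words V n, ∑ i, g (w ++ [i]) := by
  rw [words, Finset.sum_image, Finset.sum_product]
  rintro ⟨w, i⟩ - ⟨w', i'⟩ - h
  obtain ⟨h1, h2⟩ := List.append_inj' h rfl
  simp_all

lemma tsum_eq_sum_words {g : List V → ℝ} {N : ℕ} (h : ∀ w : List V, N < w.length → g w = 0) :
    ∑' w, g w = g [] + ∑ n ∈ Finset.range N, ∑ w ∈ words V n, ∑ i, g (w ++ [i]) := by
  rw [tsum_eq_sum (s := (Finset.range (N + 1)).biUnion (words V))]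
  · rw [Finset.sum_biUnion, Finset.sum_range_succ']
    · simp only [sum_words_succ]
      simp [words, add_comm]
    · intro m _ n _ hmn
      exact Finset.disjoint_left.2 fun w hm hn => hmn ((mem_words.1 hm).symm.trans (mem_words.1 hn))
  · intro w hw
    refine h w ?_
    by_contra! hle
    exact hw (Finset.mem_biUnion.2 ⟨_, Finset.mem_range.2 (Nat.lt_succ_of_le hle), mem_words.2 rfl⟩)

end Words

section Markov

variable {V R : Type*} [Fintype V] {α : V → ℝ} {a : V → R → R}

/-- The transition operator of the random walk driven by the maps `a i`. -/
def avg (α : V → ℝ) (a : V → R → R) (f : R → ℝ) : R → ℝ := fun η => ∑ i, α i * f (a i η)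

lemma sum_words_eq_avg_iterate [DecidableEq V] (n : ℕ) (f : R → ℝ) (η : R) :
    ∑ w ∈ words V n, wordProb α w * f (w.foldl (fun x i => a i x) η) = (avg α a)^[n] f η := by
  induction n generalizing f with
  | zero => simp [words, wordProb]
  | succ n ih =>
    rw [sum_words_succ, Function.iterate_succ_apply, ← ih]
    refine Finset.sum_congr rfl fun w _ => ?_
    simp only [avg, Finset.mul_sum, wordProb, List.map_append, List.prod_append,
      List.foldl_append, List.map_cons, List.map_nil, List.prod_singleton, List.foldl_cons,
      List.foldl_nil, mul_assoc]

lemma avg_iterate_nonneg (hα : ∀ i, 0 < α i) {f : R → ℝ} (h : ∀ x, 0 ≤ f x) (n : ℕ) (x : R) :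
    0 ≤ (avg α a)^[n] f x := by
  induction n generalizing x with
  | zero => exact h x
  | succ n ih =>
    rw [Function.iterate_succ_apply']
    exact Finset.sum_nonneg fun i _ => mul_nonneg (hα i).le (ih _)

lemma avg_iterate_add_const (hsum : ∑ i, α i = 1) (b c : ℝ) (f : R → ℝ) (n : ℕ) (x : R) :
    (avg α a)^[n] (fun y => b * f y + c) x = b * (avg α a)^[n] f x + c := by
  induction n generalizing x with
  | zero => rfl
  | succ n ih =>
    simp only [Function.iterate_succ_apply']
    rw [avg]
    simp only [ih, mul_add, Finset.sum_add_distrib, ← Finset.sum_mul, hsum, one_mul]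
    rw [avg, Finset.mul_sum]
    congr 1
    exact Finset.sum_congr rfl fun i _ => by ring

lemma wordProb_mul_le_avg_iterate (hα : ∀ i, 0 < α i) {f : R → ℝ} (h : ∀ x, 0 ≤ f x)
    (w : List V) (x : R) :
    wordProb α w * f (w.foldl (fun x i => a i x) x) ≤ (avg α a)^[w.length] f x := by
  induction w generalizing x with
  | nil => simp [wordProb]
  | cons i w ih =>
    rw [List.length_cons, Function.iterate_succ_apply', avg, List.foldl_cons]
    refine le_trans ?_ (Finset.single_le_sum (fun j _ => mul_nonneg (hα j).le
      (avg_iterate_nonneg hα h _ _)) (Finset.mem_univ i))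
    have := mul_le_mul_of_nonneg_left (ih (a i x)) (hα i).le
    simpa [wordProb, mul_assoc] using this

variable [Fintype R]

/-- Doeblin minorization. -/
lemma exists_minorization [Nonempty R] (hα : ∀ i, 0 < α i) {z : V} (hz : ∀ x, a z x = x)
    (htrans : ∀ x y, ∃ w : List V, w.foldl (fun x i => a i x) x = y) :
    ∃ (N : ℕ) (c : ℝ), 0 < c ∧ ∀ f : R → ℝ, (∀ x, 0 ≤ f x) → ∀ x y,
      c * f y ≤ (avg α a)^[N] f x := by
  choose W hW using htrans
  let N := ∑ p : R × R, (W p.1 p.2).length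
  have hN : ∀ x y, (W x y).length ≤ N := fun x y =>
    Finset.single_le_sum (f := fun p : R × R => (W p.1 p.2).length) (fun _ _ => Nat.zero_le _)
      (Finset.mem_univ (x, y))
  let W' : R → R → List V := fun x y => W x y ++ List.replicate (N - (W x y).length) z
  have hlen : ∀ x y, (W' x y).length = N := fun x y => by
    have := hN x y
    simp only [W', List.length_append, List.length_replicate]
    omega
  have hrep : ∀ (n : ℕ) x, (List.replicate n z).foldl (fun x i => a i x) x = x := fun n x => by
    induction n with
    | zero => rfl
    | succ n ih => rw [List.replicate_succ, List.foldl_cons, hz, ih]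
  have hW' : ∀ x y, (W' x y).foldl (fun x i => a i x) x = y := fun x y => by
    simp only [W']
    rw [List.foldl_append, hW, hrep]
  obtain ⟨p, -, hp⟩ := Finset.exists_min_image Finset.univ
    (fun p : R × R => wordProb α (W' p.1 p.2)) Finset.univ_nonempty
  refine ⟨N, wordProb α (W' p.1 p.2), wordProb_pos hα _, fun f hf x y => ?_⟩
  have h1 := wordProb_mul_le_avg_iterate (a := a) hα hf (W' x y) x
  rw [hlen, hW'] at h1
  exact (mul_le_mul_of_nonneg_right (hp (x, y) (Finset.mem_univ _)) (hf y)).trans h1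

lemma sum_avg_iterate (hsum : ∑ i, α i = 1) (ha : ∀ i, Function.Bijective (a i)) (f : R → ℝ)
    (n : ℕ) : ∑ x, (avg α a)^[n] f x = ∑ x, f x := by
  induction n generalizing f with
  | zero => rfl
  | succ n ih =>
    rw [Function.iterate_succ_apply, ih]
    simp only [avg]
    rw [Finset.sum_comm]
    have : ∀ i, ∑ x, α i * f (a i x) = α i * ∑ x, f x := fun i => by
      rw [← Finset.mul_sum, (ha i).sum_comp f]
    simp only [this, ← Finset.sum_mul, hsum, one_mul]

/-- Convergence of the random walk to the uniform distribution. -/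
lemma avg_iterate_tendsto [Nonempty R] (hα : ∀ i, 0 < α i) (hsum : ∑ i, α i = 1)
    (ha : ∀ i, Function.Bijective (a i)) {z : V} (hz : ∀ x, a z x = x)
    (htrans : ∀ x y, ∃ w : List V, w.foldl (fun x i => a i x) x = y) (f : R → ℝ) (x : R) :
    Tendsto (fun n => (avg α a)^[n] f x) atTop (nhds ((∑ y, f y) / Fintype.card R)) := by
  obtain ⟨N, c, hc, hmin⟩ := exists_minorization (α := α) (a := a) hα hz htrans
  have hκ : (0 : ℝ) < Fintype.card R := by exact_mod_cast Fintype.card_pos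
  set r : ℝ := 1 - min c (1 / 2) with hr
  have hr0 : 0 ≤ r := by have := min_le_right c (1 / 2); linarith
  have hr1 : r < 1 := by have : 0 < min c (1 / 2) := lt_min hc (by norm_num); linarith
  have hmean : ∀ g : R → ℝ, (∀ y, 0 ≤ g y) → ∀ y,
      min c (1 / 2) * ((∑ u, g u) / Fintype.card R) ≤ (avg α a)^[N] g y := by
    intro g hg y
    have h0 : 0 ≤ (∑ u, g u) / Fintype.card R := div_nonneg (Finset.sum_nonneg fun u _ => hg u) hκ.le
    refine (mul_le_mul_of_nonneg_right (min_le_left _ _) h0).trans ?_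
    rw [mul_div_assoc', div_le_iff₀ hκ, Finset.mul_sum]
    refine (Finset.sum_le_sum fun u _ => hmin g hg y u).trans ?_
    simp [mul_comm]
  have hcontr : ∀ (g : R → ℝ) (C : ℝ), ∑ y, g y = 0 → (∀ y, |g y| ≤ C) → ∀ y,
      |(avg α a)^[N] g y| ≤ r * C := by
    intro g C hg hC y
    have h1 := hmean (fun u => 1 * g u + C) (fun u => by have := neg_abs_le (g u); linarith [hC u]) y
    have h2 := hmean (fun u => -1 * g u + C) (fun u => by have := le_abs_self (g u); linarith [hC u]) y
    rw [avg_iterate_add_const hsum, Finset.sum_add_distrib, ← Finset.mul_sum, hg] at h1 h2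
    simp only [mul_zero, zero_add, Finset.sum_const, Finset.card_univ, nsmul_eq_mul] at h1 h2
    rw [mul_div_cancel_left₀ _ hκ.ne'] at h1 h2
    rw [abs_le, hr]
    constructor <;> linarith
  set μ : ℝ := (∑ y, f y) / Fintype.card R with hμ
  let g : R → ℝ := fun y => 1 * f y + -μ
  have hgn : ∀ n y, (avg α a)^[n] g y = (avg α a)^[n] f y - μ := fun n y => by
    rw [avg_iterate_add_const hsum]; ring
  have hg0 : ∑ y, g y = 0 := by
    simp only [g, one_mul, Finset.sum_add_distrib, Finset.sum_const, Finset.card_univ, nsmul_eq_mul,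
      hμ]
    field_simp
    ring
  set C : ℝ := ∑ y, |g y|
  have hC : ∀ y, |g y| ≤ C := fun y =>
    Finset.single_le_sum (f := fun y => |g y|) (fun _ _ => abs_nonneg _) (Finset.mem_univ y)
  have hiter : ∀ q y, |(avg α a)^[N * q] g y| ≤ r ^ q * C := by
    intro q
    induction q with
    | zero => simpa using hC
    | succ q ih =>
      intro y
      rw [Nat.mul_succ, Nat.add_comm, Function.iterate_add_apply, pow_succ', mul_assoc]
      exact hcontr _ _ (by rw [sum_avg_iterate hsum ha, hg0]) ih y
  have hstep : ∀ (h : R → ℝ) (B : ℝ), (∀ y, |h y| ≤ B) → ∀ k y, |(avg α a)^[k] h y| ≤ B := by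
    intro h B hB k y
    have h1 := avg_iterate_nonneg (a := a) hα (f := fun u => 1 * h u + B)
      (fun u => by have := neg_abs_le (h u); linarith [hB u]) k y
    have h2 := avg_iterate_nonneg (a := a) hα (f := fun u => -1 * h u + B)
      (fun u => by have := le_abs_self (h u); linarith [hB u]) k y
    rw [avg_iterate_add_const hsum] at h1 h2
    rw [abs_le]
    constructor <;> linarith
  rw [Metric.tendsto_atTop]
  intro ε hε
  have hlim : Tendsto (fun q => r ^ q * C) atTop (nhds 0) := by
    simpa using (tendsto_pow_atTop_nhds_zero_of_lt_one hr0 hr1).mul_const C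
  obtain ⟨q, hq⟩ := (hlim.eventually_lt_const hε).exists
  refine ⟨N * q, fun n hn => ?_⟩
  obtain ⟨k, rfl⟩ := Nat.exists_eq_add_of_le hn
  rw [Real.dist_eq, ← hgn, Nat.add_comm, Function.iterate_add_apply]
  exact (hstep _ _ (hiter q) k x).trans_lt hq

end Markov

section Threshold

variable {V : Type*} [Fintype V] [DecidableEq V] {A : V → V → ℕ} {z : V}

lemma totalMass_nonneg (hE : Eulerian A) {ρ : V → ℤ} (hρ : ZRec A z ρ) : 0 ≤ totalMass ρ :=
  Finset.sum_nonneg fun i _ => hρ.nonneg hE i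

/-- The recurrent part of the closed chain. -/
def recChain (A : V → V → ℕ) (z : V) (ρ : V → ℤ) (w : List V) : V → ℤ :=
  w.foldl (fun η i => openAdd A z i η) ρ

/-- The `δ_z` coefficient of the closed chain. -/
def level (A : V → V → ℕ) (z : V) (s ρ : V → ℤ) (w : List V) : ℤ :=
  totalMass s + w.length - totalMass (recChain A z ρ w)

lemma ZRec.recChain (hE : Eulerian A) (hC : Connected A) {ρ : V → ℤ} (hρ : ZRec A z ρ)
    (w : List V) : ZRec A z (recChain A z ρ w) := by
  induction w generalizing ρ with
  | nil => exact hρ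
  | cons i w ih => exact ih (hρ.openAdd hE hC i)

lemma recChain_concat (ρ : V → ℤ) (w : List V) (i : V) :
    recChain A z ρ (w ++ [i]) = openAdd A z i (recChain A z ρ w) := by
  simp [recChain, List.foldl_append]

lemma level_concat (s ρ : V → ℤ) (w : List V) (i : V) :
    level A z s ρ (w ++ [i]) = level A z s ρ w + burstOut A z i (recChain A z ρ w) := by
  simp only [level, recChain_concat, burstOut, List.length_append, List.length_singleton]
  push_cast
  ring

lemma level_le_append (hE : Eulerian A) (hC : Connected A) {ρ : V → ℤ} (hρ : ZRec A z ρ)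
    (s : V → ℤ) (w t : List V) : level A z s ρ w ≤ level A z s ρ (w ++ t) := by
  induction t using List.reverseRecOn with
  | nil => simp
  | append_singleton t i ih =>
    rw [← List.append_assoc, level_concat]
    have := burstOut_nonneg hE hC (hρ.recChain hE hC (w ++ t)) i
    omega

lemma HasDecomp.chain (hE : Eulerian A) (hC : Connected A) {s ρ : V → ℤ} {m : ℤ}
    (h : HasDecomp A z s ρ m) (w : List V) :
    HasDecomp A z (chain A s w) (recChain A z ρ w) (level A z s ρ w) := by
  induction w generalizing s ρ m with
  | nil =>
    have : level A z s ρ [] = m := by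
      have := h.totalMass_eq
      simp only [level, recChain, List.length_nil, List.foldl_nil]
      omega
    rw [this]
    exact h
  | cons i w ih =>
    have h1 := h.closedAdd hE hC i
    have hm : totalMass (ThresholdState.closedAdd A i s) = totalMass s + 1 := by
      have := h1.totalMass_eq
      have := h.totalMass_eq
      simp only [burstOut] at *
      omega
    have hl : level A z s ρ (i :: w) =
        level A z (ThresholdState.closedAdd A i s) (ThresholdState.openAdd A z i ρ) w := by
      simp only [level, hm, List.length_cons, ThresholdState.recChain, List.foldl_cons]
      push_cast
      ring
    rw [hl]
    exact ih h1

lemma isThresholdWord_concat_iff (hE : Eulerian A) (hC : Connected A) {s ρ : V → ℤ} {m : ℤ}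
    (h : HasDecomp A z s ρ m) (w : List V) (i : V) :
    IsThresholdWord A s (w ++ [i]) ↔
      level A z s ρ w < 0 ∧ 0 ≤ level A z s ρ w + burstOut A z i (recChain A z ρ w) := by
  simp only [IsThresholdWord, (h.chain hE hC _).stabilizable_iff hE, not_lt, ← level_concat]
  rw [and_comm]
  refine and_congr_left fun _ => ⟨fun hw => hw w (List.prefix_append _ _) (by simp), ?_⟩
  intro hw w' hw' hne
  obtain ⟨t, rfl⟩ := (List.prefix_concat_iff.1 hw').resolve_left hne
  exact (level_le_append hE hC h.1 s w' t).trans_lt hw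

/-- The contribution of the `n`-step state `η` to the expected threshold burst, when the
initial mass is `c`. -/
def burstWeight (A : V → V → ℕ) (α : V → ℝ) (z : V) (c : ℤ) (n : ℕ) (η : V → ℤ) : ℝ :=
  ∑ i, if c + n - totalMass η < 0 ∧ 0 ≤ c + n - totalMass η + burstOut A z i η then
    α i * burstOut A z i η else 0

lemma thresholdExp_eq_sum (hE : Eulerian A) (hC : Connected A) (α : V → ℝ) {s ρ : V → ℤ} {m : ℤ}
    (h : HasDecomp A z s ρ m) (hm : m < 0) {N : ℕ}
    (hN : ∀ η, ZRec A z η → totalMass η ≤ totalMass s + N) {f : List V → ℝ}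
    (hf : ∀ w i, f (w ++ [i]) = burst A z i (Rz A z (chain A s (w ++ [i])))) :
    thresholdExp A α s f =
    ∑ n ∈ Finset.range N, ∑ w ∈ words V n,
      wordProb α w * burstWeight A α z (totalMass s) n (recChain A z ρ w) := by
  have hlast : ∀ w i, (if IsThresholdWord A s (w ++ [i]) then
      wordProb α (w ++ [i]) * f (w ++ [i]) else 0) =
      if level A z s ρ w < 0 ∧ 0 ≤ level A z s ρ w + burstOut A z i (recChain A z ρ w) then
        wordProb α w * (α i * burstOut A z i (recChain A z ρ w)) else 0 := by
    intro w i
    have hb : burst A z i (Rz A z (chain A s (w ++ [i]))) = burstOut A z i (recChain A z ρ w) := by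
      rw [(h.chain hE hC _).rz_eq hE, recChain_concat,
        burst_openAdd hE hC (h.1.recChain hE hC w)]
    simp only [isThresholdWord_concat_iff hE hC h, hf, hb]
    simp [wordProb, mul_assoc]
  rw [thresholdExp, tsum_eq_sum_words (N := N)]
  · have h0 : ¬ IsThresholdWord A s [] := fun hw => hw.1 ((h.stabilizable_iff hE).2 hm)
    rw [if_neg h0, zero_add]
    refine Finset.sum_congr rfl fun n _ => Finset.sum_congr rfl fun w hw => ?_
    simp only [hlast]
    rw [burstWeight, Finset.mul_sum]
    simp only [mul_ite, mul_zero, level, mem_words.1 hw]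
  · intro w hw
    obtain ⟨w, i, rfl⟩ : ∃ w' i, w = w' ++ [i] := by
      rcases List.eq_nil_or_concat w with rfl | ⟨w', i, rfl⟩
      · simp at hw
      · exact ⟨w', i, List.concat_eq_append⟩
    rw [hlast, if_neg]
    rintro ⟨h1, -⟩
    have h2 := hN _ (h.1.recChain hE hC w)
    simp only [level, List.length_append, List.length_singleton] at h1 hw
    omega

lemma burstWeight_nonneg (hE : Eulerian A) (hC : Connected A) {α : V → ℝ} (hα : ∀ i, 0 < α i)
    {η : V → ℤ} (hη : ZRec A z η) (c : ℤ) (n : ℕ) : 0 ≤ burstWeight A α z c n η :=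
  Finset.sum_nonneg fun i _ => by
    have : (0 : ℝ) ≤ burstOut A z i η := by exact_mod_cast burstOut_nonneg hE hC hη i
    have := (hα i).le
    split_ifs <;> positivity

lemma burstWeight_eq_zero (hE : Eulerian A) (hC : Connected A) (α : V → ℝ)
    {η : V → ℤ} (hη : ZRec A z η) {c : ℤ} {n : ℕ} (h : c + n + 1 < 0) :
    burstWeight A α z c n η = 0 :=
  Finset.sum_eq_zero fun i _ => if_neg fun h' => by
    have h1 := totalMass_nonneg hE (hη.openAdd hE hC i)
    have h2 := h'.2
    simp only [burstOut] at h2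
    omega

lemma sum_burstWeight (hE : Eulerian A) (hC : Connected A) (α : V → ℝ)
    {η : V → ℤ} (hη : ZRec A z η) {c : ℤ} (hc : c < 0) {N : ℕ} (hN : totalMass η ≤ c + N) :
    ∑ n ∈ Finset.range N, burstWeight A α z c n η = ∑ i, α i * (burstOut A z i η : ℝ) ^ 2 := by
  simp only [burstWeight]
  rw [Finset.sum_comm]
  refine Finset.sum_congr rfl fun i _ => ?_
  have h0 := burstOut_nonneg hE hC hη i
  have h1 := totalMass_nonneg hE (hη.openAdd hE hC i)
  have h2 : totalMass η - c - burstOut A z i η = totalMass (openAdd A z i η) - 1 - c := by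
    rw [burstOut]; ring
  have hset : (Finset.range N).filter (fun n : ℕ => c + n - totalMass η < 0 ∧
      0 ≤ c + n - totalMass η + burstOut A z i η) =
      Finset.Ico (totalMass η - c - burstOut A z i η).toNat (totalMass η - c).toNat := by
    ext n
    simp only [Finset.mem_filter, Finset.mem_range, Finset.mem_Ico]
    omega
  rw [← Finset.sum_filter, hset, Finset.sum_const, Nat.card_Ico, nsmul_eq_mul]
  have hcard : (((totalMass η - c).toNat - (totalMass η - c - burstOut A z i η).toNat : ℕ) : ℤ) =
      burstOut A z i η := by omega
  have hcard' : (((totalMass η - c).toNat - (totalMass η - c - burstOut A z i η).toNat : ℕ) : ℝ) =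
      burstOut A z i η := by exact_mod_cast hcard
  rw [hcard']
  ring

/-- The open chain on recurrent sandpiles. -/
def openStep (hE : Eulerian A) (hC : Connected A) (i : V) (η : {η : V → ℤ // ZRec A z η}) :
    {η : V → ℤ // ZRec A z η} := ⟨openAdd A z i η.1, η.2.openAdd hE hC i⟩

lemma foldl_openStep (hE : Eulerian A) (hC : Connected A) (η : {η : V → ℤ // ZRec A z η})
    (w : List V) :
    (w.foldl (fun x i => openStep hE hC i x) η).1 = recChain A z η.1 w := by
  induction w generalizing η with
  | nil => rfl
  | cons i w ih => exact ih _

lemma openStep_bijective (hE : Eulerian A) (hC : Connected A) (i : V) :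
    Function.Bijective (openStep (z := z) hE hC i) := by
  have := finite_zRec (z := z) hE
  exact Finite.injective_iff_bijective.1 fun η η' h =>
    Subtype.ext (openAdd_injective hE hC η.2 η'.2 (congrArg Subtype.val h))

lemma openStep_transitive (hE : Eulerian A) (hC : Connected A)
    (η η' : {η : V → ℤ // ZRec A z η}) :
    ∃ w : List V, w.foldl (fun x i => openStep hE hC i x) η = η' := by
  obtain ⟨w, m, h⟩ := exists_word_hasDecomp hE hC η.2 η'.1
  exact ⟨w, Subtype.ext ((foldl_openStep hE hC η w).trans (h.unique hE η'.2.hasDecomp))⟩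

lemma tsum_sq_burst (hE : Eulerian A) (hC : Connected A) (α : V → ℝ)
    [Fintype {η : V → ℤ // ZRec A z η}] :
    ∑' b : ℕ, (b : ℝ) ^ 2 * ∑ i : V, ∑' η : {η : V → ℤ // ZRec A z η},
      (α i / (kappa A z : ℝ)) * (if burst A z i η.1 = (b : ℤ) then 1 else 0) =
    ∑ η : {η : V → ℤ // ZRec A z η}, (∑ i, α i * (burstOut A z i η.1 : ℝ) ^ 2) *
      (1 / (Fintype.card {η : V → ℤ // ZRec A z η} : ℝ)) := by
  have hκ : kappa A z = Fintype.card {η : V → ℤ // ZRec A z η} := Nat.card_eq_fintype_card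
  have hburst : ∀ i (η : {η : V → ℤ // ZRec A z η}), 0 ≤ burst A z i η.1 := fun i η => by
    obtain ⟨η', rfl⟩ := (openStep_bijective hE hC i).2 η
    exact (burst_openAdd hE hC η'.2 i).symm ▸ burstOut_nonneg hE hC η'.2 i
  have hsum : HasSum (fun b : ℕ => (b : ℝ) ^ 2 * ∑ i : V, ∑' η : {η : V → ℤ // ZRec A z η},
      (α i / (kappa A z : ℝ)) * (if burst A z i η.1 = (b : ℤ) then 1 else 0))
      (∑ i, ∑ η : {η : V → ℤ // ZRec A z η},
        α i / (kappa A z : ℝ) * (burst A z i η.1 : ℝ) ^ 2) := by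
    simp only [tsum_fintype, Finset.mul_sum]
    refine hasSum_sum fun i _ => hasSum_sum fun η _ => ?_
    obtain ⟨k, hk⟩ := Int.eq_ofNat_of_zero_le (hburst i η)
    rw [hk]
    have hval : α i / (kappa A z : ℝ) * (((k : ℤ) : ℝ)) ^ 2 =
        (k : ℝ) ^ 2 * (α i / (kappa A z : ℝ) * if (k : ℤ) = (k : ℤ) then 1 else 0) := by
      simp [mul_comm]
    rw [hval]
    refine hasSum_single k fun b hb => ?_
    rw [if_neg fun h => hb (by exact_mod_cast h.symm), mul_zero, mul_zero]
  simp only [hsum.tsum_eq, Finset.sum_mul]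
  conv_rhs => rw [Finset.sum_comm]
  refine Finset.sum_congr rfl fun i _ => ?_
  rw [← (openStep_bijective hE hC i).sum_comp]
  refine Finset.sum_congr rfl fun η _ => ?_
  rw [openStep, burst_openAdd hE hC η.2, hκ]
  ring

end Threshold

end ThresholdState

open ThresholdState in
/-- The expected burst size of the threshold avalanche converges to the second
moment of the stationary burst size: `E_{s₀}[av_{i_τ→z}(ρ_τ)] → Σ_b b²·p_b`
as `|s₀| → -∞`. -/
theorem statement_7 {V : Type*} [Fintype V] [DecidableEq V]
    (A : V → V → ℕ) (hEul : Eulerian A) (hConn : Connected A)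
    (α : V → ℝ) (hαpos : ∀ j, 0 < α j) (hαsum : ∑ j, α j = 1)
    (z : V) :
    ∀ ε : ℝ, 0 < ε → ∃ K : ℤ, K < 0 ∧ ∀ s0 : V → ℤ, totalMass s0 < K →
      |thresholdExp A α s0
          (fun w => match w.getLast? with
            | some i => (burst A z i (Rz A z (chain A s0 w)) : ℝ)
            | none => 0)
        - ∑' b : ℕ, (b : ℝ) ^ 2 *
            ∑ i : V, ∑' η : {η : V → ℤ // ZRec A z η},
              (α i / (kappa A z : ℝ)) * (if burst A z i η.1 = (b : ℤ) then 1 else 0)|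
      ≤ ε := by
  intro ε hε
  have := finite_zRec (z := z) hEul
  let _ : Fintype {η : V → ℤ // ZRec A z η} := Fintype.ofFinite _
  obtain ⟨ρ₁, hρ₁⟩ := exists_zRec hEul hConn z
  have : Nonempty {η : V → ℤ // ZRec A z η} := ⟨⟨ρ₁, hρ₁⟩⟩
  rw [tsum_sq_burst hEul hConn]
  set κ : ℝ := (Fintype.card {η : V → ℤ // ZRec A z η} : ℝ)
  set T : ℝ := ∑ η : {η : V → ℤ // ZRec A z η}, ∑ i, α i * (burstOut A z i η.1 : ℝ) ^ 2
  have hT : 0 ≤ T := Finset.sum_nonneg fun η _ => Finset.sum_nonneg fun i _ =>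
    mul_nonneg (hαpos i).le (sq_nonneg _)
  set δ : ℝ := ε / (T + 1)
  have hδ : 0 < δ := by positivity
  have hev : ∀ᶠ n in atTop, ∀ x η : {η : V → ℤ // ZRec A z η},
      |(avg α (openStep hEul hConn))^[n] (fun y => if y = η then 1 else 0) x - 1 / κ| < δ := by
    rw [eventually_all]; intro x
    rw [eventually_all]; intro η
    have h := avg_iterate_tendsto hαpos hαsum (openStep_bijective hEul hConn)
      (fun x => Subtype.ext (openAdd_sink hEul hConn x.2)) (openStep_transitive hEul hConn)
      (fun y => if y = η then 1 else 0) x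
    rw [Finset.sum_ite_eq' Finset.univ η, if_pos (Finset.mem_univ η)] at h
    exact (Metric.tendsto_nhds.1 h δ hδ).mono fun n hn => by rwa [Real.dist_eq] at hn
  obtain ⟨n₀, hn₀⟩ := eventually_atTop.1 hev
  refine ⟨-(n₀ + 1), by omega, fun s hs => ?_⟩
  obtain ⟨ρ, m, h⟩ := exists_hasDecomp hEul hConn z s
  have hm : m < 0 := by
    have := h.totalMass_eq
    have := totalMass_nonneg hEul h.1
    omega
  obtain ⟨N, hN⟩ : ∃ N : ℕ, ∀ η, ZRec A z η → totalMass η ≤ totalMass s + N := by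
    obtain ⟨M, -, hM⟩ := Finset.exists_max_image Finset.univ
      (fun η : {η : V → ℤ // ZRec A z η} => totalMass η.1) Finset.univ_nonempty
    refine ⟨(totalMass M.1 - totalMass s).toNat, fun η hη => ?_⟩
    have := hM ⟨η, hη⟩ (Finset.mem_univ _)
    simp only at this
    omega
  rw [thresholdExp_eq_sum hEul hConn α h hm hN (hf := ?_)]
  swap
  · simp
  set q : ℕ → {η : V → ℤ // ZRec A z η} → ℝ := fun n η =>
    (avg α (openStep hEul hConn))^[n] (fun y => if y = η then 1 else 0) ⟨ρ, h.1⟩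
  have hq : ∀ n, ∑ w ∈ words V n,
      wordProb α w * burstWeight A α z (totalMass s) n (recChain A z ρ w) =
      ∑ η, burstWeight A α z (totalMass s) n η.1 * q n η := by
    intro n
    simp only [q, ← sum_words_eq_avg_iterate, Finset.mul_sum]
    rw [Finset.sum_comm]
    refine Finset.sum_congr rfl fun w _ => ?_
    rw [← foldl_openStep hEul hConn ⟨ρ, h.1⟩ w]
    simp [mul_comm]
  have hw : ∀ η : {η : V → ℤ // ZRec A z η},
      ∑ n ∈ Finset.range N, burstWeight A α z (totalMass s) n η.1 =
        ∑ i, α i * (burstOut A z i η.1 : ℝ) ^ 2 := fun η =>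
    sum_burstWeight hEul hConn α η.2 (by omega) (hN _ η.2)
  simp only [hq]
  rw [Finset.sum_comm, ← Finset.sum_sub_distrib]
  calc _ ≤ ∑ η : {η : V → ℤ // ZRec A z η}, (∑ i, α i * (burstOut A z i η.1 : ℝ) ^ 2) * δ := by
        refine (Finset.abs_sum_le_sum_abs _ _).trans (Finset.sum_le_sum fun η _ => ?_)
        rw [← hw, Finset.sum_mul, Finset.sum_mul, ← Finset.sum_sub_distrib]
        refine (Finset.abs_sum_le_sum_abs _ _).trans (Finset.sum_le_sum fun n _ => ?_)
        rw [← mul_sub, abs_mul, abs_of_nonneg (burstWeight_nonneg hEul hConn hαpos η.2 _ _)]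
        by_cases hn : n₀ ≤ n
        · exact mul_le_mul_of_nonneg_left (hn₀ n hn ⟨ρ, h.1⟩ η).le
            (burstWeight_nonneg hEul hConn hαpos η.2 _ _)
        · rw [burstWeight_eq_zero hEul hConn α η.2 (by omega), zero_mul, zero_mul]
    _ = T * δ := by rw [← Finset.sum_mul]
    _ ≤ ε := by
        rw [mul_div_assoc', div_le_iff₀ (by positivity)]
        nlinarith
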